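/- arXiv:math/0703383 — 2 statements merged into one kernel-verified Lean document; each statement's English description precedes it below -/
import Mathlib

section
/- In weight 1 there are exactly two true deformations of 𝔪₀ up to scalar: an admissible function a : ℤ × ℤ → K satisfies the cocycle recurrence and M_1(a)(i,j,k) = 0 for all integers i,j,k if and only if there exists t ∈ K such that either a = t·F_2 (the 2-family), or a(j,k) = t·(k−j)·(j−1)!·(k−1)!/(j+k)! for all 2 ≤ j < k (the family arising from the subalgebra L₁{2} of the positive part of the Witt algebra). -/
/-- `a : ℤ × ℤ → K` (curried) is admissible: antisymmetric, and vanishing whenever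
one of the indices is `≤ 1`. -/
def IsAdmissible {K : Type*} [Field K] (a : ℤ → ℤ → K) : Prop :=
  (∀ i j : ℤ, a j i = -a i j) ∧ (∀ i j : ℤ, i ≤ 1 ∨ j ≤ 1 → a i j = 0)

/-- `a` satisfies the cocycle recurrence `a (i+1) j + a i (j+1) = a i j` for `i, j ≥ 2`. -/
def CocycleRec {K : Type*} [Field K] (a : ℤ → ℤ → K) : Prop :=
  ∀ i j : ℤ, 2 ≤ i → 2 ≤ j → a (i + 1) j + a i (j + 1) = a i j

/-- The weight-`l` Massey square of `a`. -/
def MasseySq {K : Type*} [Field K] (l : ℤ) (a : ℤ → ℤ → K) (i j k : ℤ) : K :=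
  a i j * a (i + j + l) k + a j k * a (j + k + l) i + a k i * a (k + i + l) j

/-- Auxiliary for the `m`-family: its values on pairs `(i,j)` with `2 ≤ i < j`. -/
def famAux (K : Type*) [Field K] (m i j : ℤ) : K :=
  if 2 ≤ i ∧ i < j ∧ i ≤ m ∧ m + 1 ≤ j then
    (-1 : K) ^ (m - i).toNat * ((j - m - 1).toNat.choose (m - i).toNat : K)
  else 0

/-- The `m`-family `F_m`: for `2 ≤ i < j`, `F_m(i,j) = (-1)^(m-i) * C(j-m-1, m-i)` if
`i ≤ m` and `j ≥ m+1`, and `0` otherwise; extended antisymmetrically, and `0` when an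
index is `≤ 1`. -/
def Fam (K : Type*) [Field K] (m i j : ℤ) : K := famAux K m i j - famAux K m j i

/-- The Massey equations in degrees up to 15 for the values `y, 1, z, w, v, u` of a cocycle on the
pairs `(i, i + 1)`, `2 ≤ i ≤ 7`, determine `y`, `z` and `w`. -/
theorem massey_system_unique {K : Type*} [Field K] [CharZero K] {y z w v u : K}
    (hA : 4 = 3 * z * (y + 1))
    (hB : 5 * z - 10 * z ^ 2 - 3 * y * w + 2 * w + 4 * z * w = 0)
    (hC : 5 * z ^ 2 - 4 * w - 6 * z * w + 2 * v + z * v = 0)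
    (hD : 6 * w - 21 * z * w + 20 * w ^ 2 - 3 * y * v + 5 * v - 5 * w * v = 0)
    (hE : 6 * z * w - 15 * w ^ 2 - 4 * v + 3 * z * v + 10 * w * v + 2 * u - z * u - w * u = 0)
    (hF : 6 * w ^ 2 - 5 * z * v - 10 * w * v + 5 * z * u + 4 * w * u = 0) :
    y = 7 ∧ z = 1 / 6 ∧ w = 1 / 33 := by
  have hz : z ≠ 0 := by
    rintro rfl
    norm_num at hA
  have hw : w * (4 - 5 * z - 4 * z ^ 2) = 5 * z ^ 2 * (1 - 2 * z) := by
    linear_combination w * hA - z * hB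
  have hv : v * (2 + z) * (4 - 5 * z - 4 * z ^ 2) = 5 * z ^ 3 * (3 - 8 * z) := by
    linear_combination (4 + 6 * z) * hw + (4 - 5 * z - 4 * z ^ 2) * hC
  have hq : 4 - 5 * z - 4 * z ^ 2 ≠ 0 := by
    intro h
    have h1 : 1 - 2 * z = 0 := by
      rw [h, mul_zero] at hw
      simpa [hz] using hw.symm
    have h2 : z = 1 / 2 := by linear_combination (-1 / 2) * h1
    rw [h2] at h
    norm_num at h
  have hz2 : 2 + z ≠ 0 := by
    intro h
    have h1 : 3 - 8 * z = 0 := by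
      rw [h, mul_zero, zero_mul] at hv
      simpa [hz] using hv.symm
    have h2 : z = -2 := by linear_combination h
    rw [h2] at h1
    norm_num at h1
  have hw' : w = 5 * z ^ 2 * (1 - 2 * z) / (4 - 5 * z - 4 * z ^ 2) := by
    rw [eq_div_iff hq, hw]
  have hv' : v = 5 * z ^ 3 * (3 - 8 * z) / ((2 + z) * (4 - 5 * z - 4 * z ^ 2)) := by
    rw [eq_div_iff (mul_ne_zero hz2 hq), ← hv]
    ring
  have hy' : y = 4 / (3 * z) - 1 := by
    field_simp
    linear_combination -hA
  have key : (1 - 2 * z) * (1 - 6 * z) * (8 - 20 * z + 7 * z ^ 2) = 0 := by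
    rw [hw', hv', hy'] at hD
    generalize hqq : 4 - 5 * z - 4 * z ^ 2 = q at hD hq
    field_simp at hD
    rw [← hqq] at hD
    have : z ^ 3 * ((1 - 2 * z) * (1 - 6 * z) * (8 - 20 * z + 7 * z ^ 2)) = 0 := by
      linear_combination (-1 / 10) * hD
    exact (mul_eq_zero.1 this).resolve_left (pow_ne_zero 3 hz)
  rcases mul_eq_zero.1 key with h | h
  · rcases mul_eq_zero.1 h with h | h
    · exfalso
      have h2 : z = 1 / 2 := by linear_combination (-1 / 2) * h
      subst h2
      norm_num at hw
      subst hw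
      grind
    · have h2 : z = 1 / 6 := by linear_combination (-1 / 6) * h
      subst h2
      norm_num at hy' hw'
      exact ⟨hy', rfl, by rw [hw']⟩
  · exfalso
    grind

section Cocycles

variable {K : Type*} [Field K] {a b : ℤ → ℤ → K}

theorem IsAdmissible.sub_smul (ha : IsAdmissible a) (hb : IsAdmissible b) (t : K) :
    IsAdmissible fun i j => a i j - t * b i j := by
  refine ⟨fun i j => ?_, fun i j h => ?_⟩
  · linear_combination ha.1 i j - t * hb.1 i j
  · simp [ha.2 i j h, hb.2 i j h]

theorem CocycleRec.sub_smul (ha : CocycleRec a) (hb : CocycleRec b) (t : K) :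
    CocycleRec fun i j => a i j - t * b i j := by
  intro i j hi hj
  linear_combination ha i j hi hj - t * hb i j hi hj

theorem masseySq_eq_zero_of_le (ha : IsAdmissible a) (l : ℤ) {i j k : ℤ}
    (h : i ≤ 1 ∨ j ≤ 1 ∨ k ≤ 1) : MasseySq l a i j k = 0 := by
  unfold MasseySq
  rcases h with h | h | h
  · simp [ha.2 i j (.inl h), ha.2 k i (.inr h), ha.2 (j + k + l) i (.inr h)]
  · simp [ha.2 i j (.inr h), ha.2 j k (.inl h), ha.2 (k + i + l) j (.inr h)]
  · simp [ha.2 j k (.inr h), ha.2 k i (.inl h), ha.2 (i + j + l) k (.inr h)]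

theorem IsAdmissible.apply_self [CharZero K] (ha : IsAdmissible a) (i : ℤ) : a i i = 0 :=
  self_eq_neg.1 (ha.1 i i)

theorem CocycleRec.step (hc : CocycleRec a) {i j k l : ℤ} (hi : 2 ≤ i) (hj : 2 ≤ j)
    (hk : k = i + 1) (hl : l = j + 1) : a i l = a i j - a k j := by
  subst hk hl
  linear_combination hc i j hi hj

/-- If a cocycle vanishes on one antidiagonal, it is alternating along the next one. -/
theorem CocycleRec.alternating (hc : CocycleRec a) {s : ℤ}
    (h0 : ∀ i j : ℤ, 2 ≤ i → 2 ≤ j → i + j + 1 = s → a i j = 0) (n : ℕ) {i j : ℤ}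
    (hi : 2 ≤ i) (hj : 2 ≤ j) (hs : i + n + j = s) :
    a (i + n) j = (-1) ^ n * a i (j + n) := by
  induction n generalizing j with
  | zero => simp
  | succ n ih =>
    push_cast at hs ⊢
    have h1 := hc (i + n) j (by omega) hj
    rw [h0 (i + n) j (by omega) hj (by omega), ih (j := j + 1) (by omega) (by omega),
      show i + n + 1 = i + (n + 1) by ring, show j + 1 + n = j + (n + 1) by ring] at h1
    rw [pow_succ]
    linear_combination h1

theorem CocycleRec.antidiagonal_eq_zero (hc : CocycleRec a) {s : ℤ}
    (h0 : ∀ i j : ℤ, 2 ≤ i → 2 ≤ j → i + j + 1 = s → a i j = 0)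
    {p q : ℤ} (hp : 2 ≤ p) (hq : 2 ≤ q) (hpq : p + q = s) (hz : a p q = 0)
    {i j : ℤ} (hi : 2 ≤ i) (hj : 2 ≤ j) (hs : i + j = s) : a i j = 0 := by
  have h2 : a 2 (s - 2) = 0 := by
    obtain ⟨n, hn⟩ := Int.eq_ofNat_of_zero_le (sub_nonneg.2 hp)
    have := hc.alternating h0 n (i := 2) (j := q) le_rfl hq (by omega)
    rw [show 2 + (n : ℤ) = p by omega, show q + n = s - 2 by omega, hz] at this
    simpa using this.symm
  obtain ⟨n, hn⟩ := Int.eq_ofNat_of_zero_le (sub_nonneg.2 hi)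
  have := hc.alternating h0 n (i := 2) (j := j) le_rfl hj (by omega)
  rwa [show 2 + (n : ℤ) = i by omega, show j + n = s - 2 by omega, h2, mul_zero] at this

/-- A cocycle is determined by its values on the pairs `(2, 2p - 1)`. -/
theorem CocycleRec.eq_zero [CharZero K] (hc : CocycleRec a) (ha : IsAdmissible a)
    (h : ∀ p : ℤ, 2 ≤ p → (∀ i j : ℤ, i + j ≤ 2 * p → a i j = 0) → a 2 (2 * p - 1) = 0)
    (i j : ℤ) : a i j = 0 := by
  have key : ∀ p : ℤ, 2 ≤ p → ∀ i j : ℤ, i + j ≤ 2 * p → a i j = 0 := by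
    intro p hp
    induction p, hp using Int.leInduction with
    | base =>
      intro i j hij
      by_cases h1 : i ≤ 1 ∨ j ≤ 1
      · exact ha.2 i j h1
      · obtain rfl : i = j := by omega
        exact ha.apply_self i
    | succ p hp ih =>
      have hodd : ∀ i j : ℤ, 2 ≤ i → 2 ≤ j → i + j = 2 * p + 1 → a i j = 0 :=
        fun i j hi hj hij => hc.antidiagonal_eq_zero
          (fun i j _ _ hs => ih i j (by omega)) le_rfl (by omega) (by omega) (h p hp ih) hi hj hij
      intro i j hij
      by_cases h1 : i ≤ 1 ∨ j ≤ 1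
      · exact ha.2 i j h1
      · rcases lt_trichotomy (i + j) (2 * p + 1) with hlt | heq | hgt
        · exact ih i j (by omega)
        · exact hodd i j (by omega) (by omega) heq
        · exact hc.antidiagonal_eq_zero (s := 2 * p + 2)
            (fun i j hi hj hs => hodd i j hi hj (by omega)) (p := p + 1) (q := p + 1)
            (by omega) (by omega) (by omega) (ha.apply_self _) (by omega) (by omega) (by omega)
  exact key (max 2 (max i j)) (le_max_left _ _) i j (by omega)

theorem CocycleRec.row_expansion [CharZero K] (hc : CocycleRec a) (ha : IsAdmissible a)
    {i : ℤ} (hi : 2 ≤ i) :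
    a i (i + 2) = a i (i + 1) ∧
    a i (i + 3) = a i (i + 1) - a (i + 1) (i + 2) ∧
    a i (i + 4) = a i (i + 1) - 2 * a (i + 1) (i + 2) ∧
    a i (i + 5) = a i (i + 1) - 3 * a (i + 1) (i + 2) + a (i + 2) (i + 3) ∧
    a i (i + 6) = a i (i + 1) - 4 * a (i + 1) (i + 2) + 3 * a (i + 2) (i + 3) ∧
    a i (i + 7) = a i (i + 1) - 5 * a (i + 1) (i + 2) + 6 * a (i + 2) (i + 3)
      - a (i + 3) (i + 4) ∧
    a i (i + 8) = a i (i + 1) - 6 * a (i + 1) (i + 2) + 10 * a (i + 2) (i + 3)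
      - 4 * a (i + 3) (i + 4) ∧
    a i (i + 9) = a i (i + 1) - 7 * a (i + 1) (i + 2) + 15 * a (i + 2) (i + 3)
      - 10 * a (i + 3) (i + 4) + a (i + 4) (i + 5) ∧
    a i (i + 10) = a i (i + 1) - 8 * a (i + 1) (i + 2) + 21 * a (i + 2) (i + 3)
      - 20 * a (i + 3) (i + 4) + 5 * a (i + 4) (i + 5) := by
  have e : ∀ {i : ℤ} (n : ℤ), 2 ≤ i → 1 ≤ n →
      a i (i + (n + 1)) = a i (i + n) - a (i + 1) (i + 1 + (n - 1)) := fun {i} n hi hn => by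
    rw [show i + 1 + (n - 1) = i + n by ring]
    exact hc.step hi (by omega) rfl (by ring)
  have r2 : ∀ i : ℤ, 2 ≤ i → a i (i + 2) = a i (i + 1) := fun i hi => by
    have := e 1 hi le_rfl
    norm_num [ha.apply_self] at this
    exact this
  have s1 : ∀ i : ℤ, i + 1 + 1 = i + 2 := fun i => by ring
  have s2 : ∀ i : ℤ, i + 1 + 2 = i + 3 := fun i => by ring
  have s3 : ∀ i : ℤ, i + 1 + 3 = i + 4 := fun i => by ring
  have s4 : ∀ i : ℤ, i + 1 + 4 = i + 5 := fun i => by ring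
  have r3 : ∀ i : ℤ, 2 ≤ i → a i (i + 3) = a i (i + 1) - a (i + 1) (i + 2) := fun i hi => by
    have := e 2 hi (by norm_num)
    norm_num only [r2 i hi, s1] at this
    exact this
  have r4 : ∀ i : ℤ, 2 ≤ i → a i (i + 4) = a i (i + 1) - 2 * a (i + 1) (i + 2) :=
    fun i hi => by
    have := e 3 hi (by norm_num)
    norm_num only [r3 i hi, r2 (i + 1) (by omega), s1] at this
    linear_combination this
  have r5 : ∀ i : ℤ, 2 ≤ i →
      a i (i + 5) = a i (i + 1) - 3 * a (i + 1) (i + 2) + a (i + 2) (i + 3) := fun i hi => by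
    have := e 4 hi (by norm_num)
    norm_num only [r4 i hi, r3 (i + 1) (by omega), s1, s2] at this
    linear_combination this
  have r6 : ∀ i : ℤ, 2 ≤ i →
      a i (i + 6) = a i (i + 1) - 4 * a (i + 1) (i + 2) + 3 * a (i + 2) (i + 3) :=
    fun i hi => by
    have := e 5 hi (by norm_num)
    norm_num only [r5 i hi, r4 (i + 1) (by omega), s1, s2] at this
    linear_combination this
  have r7 : ∀ i : ℤ, 2 ≤ i →
      a i (i + 7) = a i (i + 1) - 5 * a (i + 1) (i + 2) + 6 * a (i + 2) (i + 3)
        - a (i + 3) (i + 4) := fun i hi => by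
    have := e 6 hi (by norm_num)
    norm_num only [r6 i hi, r5 (i + 1) (by omega), s1, s2, s3] at this
    linear_combination this
  have r8 : ∀ i : ℤ, 2 ≤ i →
      a i (i + 8) = a i (i + 1) - 6 * a (i + 1) (i + 2) + 10 * a (i + 2) (i + 3)
        - 4 * a (i + 3) (i + 4) := fun i hi => by
    have := e 7 hi (by norm_num)
    norm_num only [r7 i hi, r6 (i + 1) (by omega), s1, s2, s3] at this
    linear_combination this
  have r9 : ∀ i : ℤ, 2 ≤ i →
      a i (i + 9) = a i (i + 1) - 7 * a (i + 1) (i + 2) + 15 * a (i + 2) (i + 3)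
        - 10 * a (i + 3) (i + 4) + a (i + 4) (i + 5) := fun i hi => by
    have := e 8 hi (by norm_num)
    norm_num only [r8 i hi, r7 (i + 1) (by omega), s1, s2, s3, s4] at this
    linear_combination this
  refine ⟨r2 i hi, r3 i hi, r4 i hi, r5 i hi, r6 i hi, r7 i hi, r8 i hi, r9 i hi, ?_⟩
  have := e 9 hi (by norm_num)
  norm_num only [r9 i hi, r8 (i + 1) (by omega), s1, s2, s3, s4] at this
  linear_combination this

end Cocycles

section Models

variable (K : Type*) [Field K]

theorem fam_two_eq (i j : ℤ) :
    Fam K 2 i j = if i = 2 ∧ 3 ≤ j then 1 else if j = 2 ∧ 3 ≤ i then -1 else 0 := by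
  have h : ∀ i j : ℤ, famAux K 2 i j = if i = 2 ∧ 3 ≤ j then 1 else 0 := by
    intro i j
    unfold famAux
    by_cases hij : i = 2 ∧ 3 ≤ j
    · obtain ⟨rfl, hj⟩ := hij
      rw [if_pos (by omega), if_pos ⟨rfl, hj⟩]
      simp
    · rw [if_neg (by omega), if_neg hij]
  unfold Fam
  rw [h, h]
  split_ifs <;> first | omega | simp

theorem fam_two_isAdmissible : IsAdmissible (Fam K 2) := by
  refine ⟨fun i j => by unfold Fam; ring, fun i j h => ?_⟩
  rw [fam_two_eq, if_neg (by omega), if_neg (by omega)]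

theorem fam_two_cocycleRec : CocycleRec (Fam K 2) := by
  intro i j hi hj
  simp only [fam_two_eq]
  split_ifs <;> first | omega | simp

theorem fam_two_masseySq (i j k : ℤ) : MasseySq 1 (Fam K 2) i j k = 0 := by
  by_cases h : i ≤ 1 ∨ j ≤ 1 ∨ k ≤ 1
  · exact masseySq_eq_zero_of_le (fam_two_isAdmissible K) 1 h
  · have h2 : ∀ i j : ℤ, 2 ≤ i → 2 ≤ j →
        Fam K 2 i j = (if i = 2 then 1 else 0) - (if j = 2 then 1 else 0) := by
      intro i j hi hj
      rw [fam_two_eq]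
      split_ifs <;> first | omega | simp
    unfold MasseySq
    rw [h2 i j (by omega) (by omega), h2 j k (by omega) (by omega), h2 k i (by omega) (by omega),
      h2 (i + j + 1) k (by omega) (by omega), h2 (j + k + 1) i (by omega) (by omega),
      h2 (k + i + 1) j (by omega) (by omega), if_neg (show ¬i + j + 1 = 2 by omega),
      if_neg (show ¬j + k + 1 = 2 by omega), if_neg (show ¬k + i + 1 = 2 by omega)]
    ring

/-- The structure constants of the subalgebra `L₁{2}` of the positive part of the Witt algebra,
in the normalization of a cocycle of weight one. -/
noncomputable def wittCocycle (i j : ℤ) : K :=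
  if 2 ≤ i ∧ 2 ≤ j then
    ((j - i : ℤ) : K) * ((i - 1).toNat.factorial : K) * ((j - 1).toNat.factorial : K) /
      ((i + j).toNat.factorial : K)
  else 0

theorem wittCocycle_natCast (m n : ℕ) :
    wittCocycle K (m + 2) (n + 2) =
      (n - m) * ((m + 1).factorial : K) * ((n + 1).factorial : K) /
        ((m + n + 4).factorial : K) := by
  unfold wittCocycle
  rw [if_pos (by omega), show ((m : ℤ) + 2 - 1).toNat = m + 1 by omega,
    show ((n : ℤ) + 2 - 1).toNat = n + 1 by omega,
    show ((m : ℤ) + 2 + (n + 2)).toNat = m + n + 4 by omega]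
  push_cast
  ring

theorem wittCocycle_isAdmissible : IsAdmissible (wittCocycle K) := by
  refine ⟨fun i j => ?_, fun i j h => if_neg (by omega)⟩
  unfold wittCocycle
  by_cases h : 2 ≤ i ∧ 2 ≤ j
  · rw [if_pos h, if_pos h.symm, add_comm j i]
    push_cast
    ring
  · rw [if_neg h, if_neg (fun h' => h h'.symm), neg_zero]

variable [CharZero K]

theorem wittCocycle_cocycleRec : CocycleRec (wittCocycle K) := by
  intro i j hi hj
  obtain ⟨m, rfl⟩ : ∃ m : ℕ, i = m + 2 := ⟨(i - 2).toNat, by omega⟩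
  obtain ⟨n, rfl⟩ : ∃ n : ℕ, j = n + 2 := ⟨(j - 2).toNat, by omega⟩
  have h1 := wittCocycle_natCast K (m + 1) n
  have h2 := wittCocycle_natCast K m (n + 1)
  push_cast at h1 h2
  rw [show (m : ℤ) + 2 + 1 = m + 1 + 2 by ring, show (n : ℤ) + 2 + 1 = n + 1 + 2 by ring, h1, h2,
    wittCocycle_natCast, show m + 1 + n + 4 = m + n + 4 + 1 by ring,
    show m + (n + 1) + 4 = m + n + 4 + 1 by ring, Nat.factorial_succ (m + 1),
    Nat.factorial_succ (n + 1), Nat.factorial_succ (m + n + 4)]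
  have h3 : ((m + n + 4).factorial : K) ≠ 0 := Nat.cast_ne_zero.2 (Nat.factorial_ne_zero _)
  have h4 : ((m + n + 4 + 1 : ℕ) : K) ≠ 0 := Nat.cast_ne_zero.2 (by omega)
  push_cast at h4 ⊢
  field_simp
  ring

theorem wittCocycle_mul_wittCocycle (m n p : ℕ) :
    wittCocycle K (m + 2) (n + 2) * wittCocycle K (m + 2 + (n + 2) + 1) (p + 2) =
      (n - m) * (p - (m + n + 3)) * (((m + 1).factorial : K) * ((n + 1).factorial : K) *
        ((p + 1).factorial : K) / ((m + n + p + 7).factorial : K)) := by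
  have h1 := wittCocycle_natCast K (m + n + 3) p
  push_cast at h1
  rw [show (m : ℤ) + 2 + (n + 2) + 1 = m + n + 3 + 2 by ring, h1, wittCocycle_natCast,
    show m + n + 3 + p + 4 = m + n + p + 7 by ring]
  have h3 : ((m + n + 4).factorial : K) ≠ 0 := Nat.cast_ne_zero.2 (Nat.factorial_ne_zero _)
  field_simp

theorem wittCocycle_masseySq (i j k : ℤ) : MasseySq 1 (wittCocycle K) i j k = 0 := by
  by_cases h : i ≤ 1 ∨ j ≤ 1 ∨ k ≤ 1
  · exact masseySq_eq_zero_of_le (wittCocycle_isAdmissible K) 1 h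
  · obtain ⟨m, rfl⟩ : ∃ m : ℕ, i = m + 2 := ⟨(i - 2).toNat, by omega⟩
    obtain ⟨n, rfl⟩ : ∃ n : ℕ, j = n + 2 := ⟨(j - 2).toNat, by omega⟩
    obtain ⟨p, rfl⟩ : ∃ p : ℕ, k = p + 2 := ⟨(k - 2).toNat, by omega⟩
    unfold MasseySq
    rw [wittCocycle_mul_wittCocycle, wittCocycle_mul_wittCocycle, wittCocycle_mul_wittCocycle,
      show n + p + m + 7 = m + n + p + 7 by ring, show p + m + n + 7 = m + n + p + 7 by ring]
    ring

theorem wittCocycle_defect_ne_zero {k : ℤ} (hk : 7 ≤ k) :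
    wittCocycle K 2 3 - wittCocycle K 3 k - wittCocycle K 2 k ≠ 0 := by
  obtain ⟨n, rfl⟩ : ∃ n : ℕ, k = n + 2 := ⟨(k - 2).toNat, by omega⟩
  have h1 := wittCocycle_natCast K 0 1
  have h2 := wittCocycle_natCast K 1 n
  have h3 := wittCocycle_natCast K 0 n
  rw [show 1 + n + 4 = n + 1 + 1 + 1 + 1 + 1 by ring] at h2
  rw [show 0 + n + 4 = n + 1 + 1 + 1 + 1 by ring] at h3
  simp only [Nat.factorial_succ] at h2 h3
  norm_num [Nat.factorial] at h1 h2 h3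
  rw [h1, h2, h3]
  have h4 : (n.factorial : K) ≠ 0 := Nat.cast_ne_zero.2 (Nat.factorial_ne_zero _)
  have h5 : ((n + 1 : ℕ) : K) ≠ 0 := Nat.cast_ne_zero.2 (by omega)
  have h6 : ((n + 1 + 1 : ℕ) : K) ≠ 0 := Nat.cast_ne_zero.2 (by omega)
  have h7 : ((n + 2 + 1 : ℕ) : K) ≠ 0 := Nat.cast_ne_zero.2 (by omega)
  have h8 : ((n + 3 + 1 : ℕ) : K) ≠ 0 := Nat.cast_ne_zero.2 (by omega)
  have h9 : ((n + 4 + 1 : ℕ) : K) ≠ 0 := Nat.cast_ne_zero.2 (by omega)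
  have h10 : (((n - 1) * (n + 8) * (n - 3) * (n + 10) : ℤ) : K) ≠ 0 := by
    refine Int.cast_ne_zero.2 ?_
    refine mul_ne_zero (mul_ne_zero (mul_ne_zero ?_ ?_) ?_) ?_ <;> omega
  intro h
  apply h10
  push_cast at *
  field_simp at h
  linear_combination h

end Models

section Massey

variable {K : Type*} [Field K] [CharZero K] {a : ℤ → ℤ → K}

/-- The values of a cocycle near the first antidiagonal on which it does not vanish. -/
theorem CocycleRec.leading_expansion (hc : CocycleRec a) (ha : IsAdmissible a) {p : ℤ}
    (hp : 2 ≤ p) (h0 : ∀ i j : ℤ, i + j ≤ 2 * p → a i j = 0) (n : ℕ) (hn : 2 ≤ p - n) :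
    a (p - n) (p + n + 1) = (-1) ^ n * a p (p + 1) ∧
    a (p - n) (p + n + 2) = (-1) ^ n * ((n + 1) * a p (p + 1)) ∧
    a (p - n) (p + n + 3) =
      (-1) ^ n * ((n + 1) * (n + 2) / 2 * a p (p + 1) - a (p + 1) (p + 2)) ∧
    a (p - n) (p + n + 4) =
      (-1) ^ n * ((n + 1) * (n + 2) * (n + 3) / 6 * a p (p + 1) -
        (n + 2) * a (p + 1) (p + 2)) ∧
    a (p - n) (p + n + 5) =
      (-1) ^ n * ((n + 1) * (n + 2) * (n + 3) * (n + 4) / 24 * a p (p + 1) -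
        (n + 2) * (n + 3) / 2 * a (p + 1) (p + 2) + a (p + 2) (p + 3)) ∧
    a (p - n) (p + n + 6) =
      (-1) ^ n * ((n + 1) * (n + 2) * (n + 3) * (n + 4) * (n + 5) / 120 * a p (p + 1) -
        (n + 2) * (n + 3) * (n + 4) / 6 * a (p + 1) (p + 2) +
        (n + 3) * a (p + 2) (p + 3)) := by
  induction n with
  | zero =>
    obtain ⟨r2, r3, r4, r5, r6, -⟩ := hc.row_expansion ha hp
    push_cast
    simp only [sub_zero, add_zero, r2, r3, r4, r5, r6]
    refine ⟨?_, ?_, ?_, ?_, ?_, ?_⟩ <;> ring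
  | succ n ih =>
    push_cast at hn ⊢
    obtain ⟨i1, i2, i3, i4, i5, i6⟩ := ih (by omega)
    have e : ∀ r : ℤ, 1 ≤ r → a (p - (n + 1)) (p + (n + 1) + r) =
        a (p - (n + 1)) (p + n + r) - a (p - n) (p + n + r) := fun r hr =>
      hc.step hn (by omega) (by ring) (by ring)
    have e1 := e 1 (by norm_num)
    have e2 := e 2 (by norm_num)
    have e3 := e 3 (by norm_num)
    have e4 := e 4 (by norm_num)
    have e5 := e 5 (by norm_num)
    have e6 := e 6 (by norm_num)
    rw [h0 _ (p + n + 1) (by omega), i1] at e1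
    rw [show p + (n : ℤ) + 2 = p + (n + 1) + 1 by ring, e1,
      show p + ((n : ℤ) + 1) + 1 = p + n + 2 by ring, i2] at e2
    rw [show p + (n : ℤ) + 3 = p + (n + 1) + 2 by ring, e2,
      show p + ((n : ℤ) + 1) + 2 = p + n + 3 by ring, i3] at e3
    rw [show p + (n : ℤ) + 4 = p + (n + 1) + 3 by ring, e3,
      show p + ((n : ℤ) + 1) + 3 = p + n + 4 by ring, i4] at e4
    rw [show p + (n : ℤ) + 5 = p + (n + 1) + 4 by ring, e4,
      show p + ((n : ℤ) + 1) + 4 = p + n + 5 by ring, i5] at e5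
    rw [show p + (n : ℤ) + 6 = p + (n + 1) + 5 by ring, e5,
      show p + ((n : ℤ) + 1) + 5 = p + n + 6 by ring, i6] at e6
    rw [e1, e2, e3, e4, e5, e6, pow_succ]
    refine ⟨?_, ?_, ?_, ?_, ?_, ?_⟩ <;> ring

theorem CocycleRec.leading_coeff_eq_zero (hc : CocycleRec a) (ha : IsAdmissible a)
    (hM : ∀ i j k : ℤ, MasseySq 1 a i j k = 0) {p : ℤ} (hp : 4 ≤ p)
    (h0 : ∀ i j : ℤ, i + j ≤ 2 * p → a i j = 0) : a p (p + 1) = 0 := by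
  by_contra hc0
  have hpK : ∀ q : ℤ, q ≠ 0 → (q : K) ≠ 0 := fun q hq => Int.cast_ne_zero.2 hq
  have hrow : ∀ k : ℤ, k ≤ p - 1 → a k (2 * p + 2) = 0 := by
    intro k hk
    have h := hM p (p + 1) k
    rw [MasseySq, h0 (p + 1) k (by omega), h0 k p (by omega), zero_mul, zero_mul, add_zero,
      add_zero, show p + (p + 1) + 1 = 2 * p + 2 by ring, ha.1 k] at h
    simpa [hc0] using h
  obtain ⟨n, rfl⟩ : ∃ n : ℕ, p = n + 3 := ⟨(p - 3).toNat, by omega⟩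
  obtain ⟨-, -, -, e1, -, e3⟩ :=
    hc.leading_expansion ha (by omega) h0 (n + 1) (by push_cast; omega)
  obtain ⟨-, -, -, -, e2, -⟩ := hc.leading_expansion ha (by omega) h0 n (by omega)
  have sgn : ∀ m : ℕ, (-1 : K) ^ m ≠ 0 := fun m => pow_ne_zero m (by simp)
  push_cast at e1 e2 e3
  rw [show (n : ℤ) + 3 - (n + 1) = 2 by ring,
    show (n : ℤ) + 3 + (n + 1) + 4 = 2 * (n + 3) + 2 by ring, hrow 2 (by omega)] at e1
  rw [show (n : ℤ) + 3 - n = 3 by ring,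
    show (n : ℤ) + 3 + n + 5 = 2 * (n + 3) + 2 by ring, hrow 3 (by omega)] at e2
  rw [show (n : ℤ) + 3 - (n + 1) = 2 by ring] at e3
  have f1 := (mul_eq_zero.1 e1.symm).resolve_left (sgn _)
  have f2 := (mul_eq_zero.1 e2.symm).resolve_left (sgn _)
  set c0 := a (n + 3) (n + 3 + 1)
  set c1 := a (n + 3 + 1) (n + 3 + 2) with hc1
  set c2 := a (n + 3 + 2) (n + 3 + 3)
  have k3 := hpK (n + 3) (by omega)
  have k4 := hpK (n + 4) (by omega)
  have k2 := hpK (n + 2) (by omega)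
  push_cast at k2 k3 k4
  have g1 : c1 = (n + 2) * (n + 4) / 6 * c0 := by
    apply mul_left_cancel₀ k3
    linear_combination -f1
  have hc1' : c1 ≠ 0 := by
    rw [g1]
    exact mul_ne_zero (div_ne_zero (mul_ne_zero k2 k4) (by norm_num)) hc0
  have h := hM 2 (n + 3 + 1) (n + 3 + 2)
  rw [MasseySq, h0 2 (n + 3 + 1) (by omega), h0 (n + 3 + 2) 2 (by omega), zero_mul, zero_mul,
    add_zero, zero_add, ← hc1, ha.1 2,
    show (n : ℤ) + 3 + 1 + (n + 3 + 2) + 1 = n + 3 + (n + 1) + 6 by ring] at h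
  have h' : a 2 (n + 3 + (n + 1) + 6) = 0 := by simpa [hc1'] using h
  rw [h'] at e3
  have f3 := (mul_eq_zero.1 e3.symm).resolve_left (sgn _)
  have k5 := hpK (2 * n + 5) (by omega)
  have k7 := hpK (2 * n + 7) (by omega)
  push_cast at k5 k7
  have : (n + 2 : K) * (n + 3) * (n + 4) * (2 * n + 5) * (2 * n + 7) * c0 = 0 := by
    linear_combination 180 * f3 - 180 * (n + 4) * f2 +
      180 * ((n + 3) * (n + 4) * (n + 5) / 6 - (n + 4) * (n + 2) * (n + 3) / 2) * g1
  simp [k2, k3, k4, k5, k7] at this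
  exact hc0 this

theorem eq_zero_of_leading_zero (hc : CocycleRec a) (ha : IsAdmissible a)
    (hM : ∀ i j k : ℤ, MasseySq 1 a i j k = 0) (h2 : a 2 3 = 0) (h3 : a 3 4 = 0)
    (i j : ℤ) : a i j = 0 := by
  refine hc.eq_zero ha (fun p hp h0 => ?_) i j
  have r := hc.row_expansion ha (i := 2) le_rfl
  norm_num [h2, h3] at r
  obtain rfl | rfl | h : p = 2 ∨ p = 3 ∨ 4 ≤ p := by omega
  · simpa using h2
  · norm_num [r]
  · exact hc.antidiagonal_eq_zero (fun i j _ _ hs => h0 i j (by omega)) (by omega) (by omega)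
      (by omega) (hc.leading_coeff_eq_zero ha hM h h0) le_rfl (by omega) rfl

theorem eq_fam_two_of_apply_eq_zero (hc : CocycleRec a) (ha : IsAdmissible a)
    (hM : ∀ i j k : ℤ, MasseySq 1 a i j k = 0) (h2 : a 2 3 ≠ 0) (h3 : a 3 4 = 0)
    (i j : ℤ) : a i j = a 2 3 * Fam K 2 i j := by
  set y := a 2 3 with hy
  set d : ℤ → ℤ → K := fun i j => a i j - y * Fam K 2 i j with hd
  have hdc : CocycleRec d := hc.sub_smul (fam_two_cocycleRec K) y
  have hda : IsAdmissible d := ha.sub_smul (fam_two_isAdmissible K) y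
  have had : ∀ i j, a i j = d i j + y * Fam K 2 i j := fun i j => by simp [hd]
  have hd3 : ∀ i j, 3 ≤ i → 3 ≤ j → a i j = d i j := fun i j hi hj => by
    rw [had, fam_two_eq, if_neg (by omega), if_neg (by omega)]
    ring
  have d23 : d 2 3 = 0 := by
    simp [hd, fam_two_eq, hy]
  refine sub_eq_zero.1 (hdc.eq_zero hda (fun p hp h0 => ?_) i j)
  have r := hdc.row_expansion hda (i := 2) le_rfl
  norm_num [d23, ← hd3, h3] at r
  obtain rfl | rfl | h : p = 2 ∨ p = 3 ∨ 4 ≤ p := by omega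
  · simpa using d23
  · norm_num [r]
  have hz : ∀ i j : ℤ, 2 ≤ i → 2 ≤ j → i + j + 1 = 2 * p + 1 → d i j = 0 :=
    fun i j _ _ hs => h0 i j (by omega)
  have e4 := hdc.alternating hz 1 (i := 3) (j := 2 * p - 3) (by omega) (by omega)
    (by push_cast; ring)
  have e5 := hdc.alternating hz 2 (i := 3) (j := 2 * p - 4) (by omega) (by omega)
    (by push_cast; ring)
  norm_num at e4 e5
  rw [show 2 * p - 3 + 1 = 2 * p - 2 by ring] at e4
  rw [show 2 * p - 4 + 2 = 2 * p - 2 by ring] at e5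
  have s3 := hdc.step (i := 3) (j := 2 * p - 2) (k := 4) (l := 2 * p - 1) (by omega) (by omega)
    (by omega) (by omega)
  have s4 := hdc.step (i := 4) (j := 2 * p - 3) (k := 5) (l := 2 * p - 2) (by omega) (by omega)
    (by omega) (by omega)
  have s5 := hdc.step (i := 5) (j := 2 * p - 4) (k := 6) (l := 2 * p - 3) (by omega) (by omega)
    (by omega) (by omega)
  have m := hM 2 3 (2 * p - 4)
  have ak2 : a (2 * p - 4) 2 = -y := by
    rw [had, h0 _ _ (by omega), fam_two_eq, if_neg (by omega), if_pos (by omega)]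
    ring
  rw [MasseySq, ← hy, ak2, hd3 3 _ (by omega) (by omega), h0 3 (2 * p - 4) (by omega), zero_mul,
    hd3 _ _ (by omega) (by omega), hd3 _ _ (by omega) (by omega),
    show 2 * p - 4 + 2 + 1 = 2 * p - 1 by ring, hda.1 3] at m
  norm_num only at m
  have m' : y * (3 * d 3 (2 * p - 2)) = 0 := by
    linear_combination m + y * (s4 - s3 - s5 + e4 - e5)
  have e : d 3 (2 * p - 2) = 0 := by simpa [h2] using m'
  exact hdc.antidiagonal_eq_zero hz (by omega) (by omega) (by omega) e le_rfl (by omega) (by ring)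

theorem eq_wittCocycle_of_apply_ne_zero (hc : CocycleRec a) (ha : IsAdmissible a)
    (hM : ∀ i j k : ℤ, MasseySq 1 a i j k = 0) (h3 : a 3 4 ≠ 0)
    (i j : ℤ) : a i j = 420 * a 3 4 * wittCocycle K i j := by
  obtain ⟨hy, hz, hw⟩ : a 2 3 = 7 * a 3 4 ∧ a 4 5 = a 3 4 / 6 ∧ a 5 6 = a 3 4 / 33 := by
    have q2 := hc.row_expansion ha (i := 2) le_rfl
    have q3 := hc.row_expansion ha (i := 3) (by norm_num)
    have q4 := hc.row_expansion ha (i := 4) (by norm_num)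
    have q5 := hc.row_expansion ha (i := 5) (by norm_num)
    have q6 := hc.row_expansion ha (i := 6) (by norm_num)
    norm_num only at q2 q3 q4 q5 q6
    have mA := hM 2 3 4
    have mB := hM 2 4 5
    have mC := hM 3 4 5
    have mD := hM 2 5 6
    have mE := hM 3 5 6
    have mF := hM 4 5 6
    unfold MasseySq at mA mB mC mD mE mF
    norm_num only at mA mB mC mD mE mF
    rw [ha.1 4 6, ha.1 2 8, ha.1 2 4, ha.1 3 7] at mA
    rw [ha.1 5 7, ha.1 2 10, ha.1 2 5, ha.1 4 8] at mB
    rw [ha.1 5 8, ha.1 3 10, ha.1 3 5, ha.1 4 9] at mC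
    rw [ha.1 6 8, ha.1 2 12, ha.1 2 6, ha.1 5 9] at mD
    rw [ha.1 6 9, ha.1 3 12, ha.1 3 6, ha.1 5 10] at mE
    rw [ha.1 6 10, ha.1 4 12, ha.1 4 6, ha.1 5 11] at mF
    simp only [q2, q3, q4, q5, q6] at mA mB mC mD mE mF
    have key := massey_system_unique (y := a 2 3 / a 3 4) (z := a 4 5 / a 3 4) (w := a 5 6 / a 3 4)
      (v := a 6 7 / a 3 4) (u := a 7 8 / a 3 4)
      (by field_simp; linear_combination mA)
      (by field_simp; linear_combination mB)
      (by field_simp; linear_combination mC)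
      (by field_simp; linear_combination mD)
      (by field_simp; linear_combination mE)
      (by field_simp; linear_combination mF)
    field_simp at key
    refine ⟨?_, ?_, ?_⟩
    · linear_combination key.1
    · linear_combination (1 / 6) * key.2.1
    · linear_combination (1 / 33) * key.2.2
  set t : K := 420 * a 3 4 with ht
  have ht0 : t ≠ 0 := mul_ne_zero (by norm_num) h3
  set d : ℤ → ℤ → K := fun i j => a i j - t * wittCocycle K i j with hd
  have hdc : CocycleRec d := hc.sub_smul (wittCocycle_cocycleRec K) t
  have hda : IsAdmissible d := ha.sub_smul (wittCocycle_isAdmissible K) t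
  have had : ∀ i j, a i j = d i j + t * wittCocycle K i j := fun i j => by simp [hd]
  have wit : ∀ m n : ℕ, d (m + 2) (n + 2) = a (m + 2) (n + 2) - 420 * a 3 4 *
      ((n - m) * ((m + 1).factorial : K) * ((n + 1).factorial : K) /
        ((m + n + 4).factorial : K)) := fun m n => by rw [← wittCocycle_natCast]
  have d23 := wit 0 1
  have d34 := wit 1 2
  have d45 := wit 2 3
  have d56 := wit 3 4
  norm_num [Nat.factorial, hy, hz, hw] at d23 d34 d45 d56
  ring_nf at d23 d34 d45 d56
  refine sub_eq_zero.1 (hdc.eq_zero hda (fun p hp h0 => ?_) i j)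
  have r := hdc.row_expansion hda (i := 2) le_rfl
  norm_num [d23, d34, d45, d56] at r
  obtain rfl | rfl | rfl | rfl | h : p = 2 ∨ p = 3 ∨ p = 4 ∨ p = 5 ∨ 6 ≤ p := by omega
  · simpa using d23
  · norm_num [r]
  · norm_num [r]
  · norm_num [r]
  have hz : ∀ i j : ℤ, 2 ≤ i → 2 ≤ j → i + j + 1 = 2 * p + 1 → d i j = 0 :=
    fun i j _ _ hs => h0 i j (by omega)
  have e3 := hdc.alternating hz 1 (i := 2) (j := 2 * p - 2) (by omega) (by omega)
    (by push_cast; ring)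
  have e6 := hdc.alternating hz 4 (i := 2) (j := 2 * p - 5) (by omega) (by omega)
    (by push_cast; ring)
  norm_num at e3 e6
  rw [show 2 * p - 2 + 1 = 2 * p - 1 by ring] at e3
  rw [show 2 * p - 5 + 4 = 2 * p - 1 by ring] at e6
  have m := hM 2 3 (2 * p - 5)
  have m' := wittCocycle_masseySq K 2 3 (2 * p - 5)
  unfold MasseySq at m m'
  rw [show (2 : ℤ) + 3 + 1 = 6 by norm_num, show 3 + (2 * p - 5) + 1 = 2 * p - 1 by ring,
    show 2 * p - 5 + 2 + 1 = 2 * p - 2 by ring] at m m'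
  rw [had 2 3, h0 2 3 (by omega), had 3 (2 * p - 5), h0 3 (2 * p - 5) (by omega),
    had (2 * p - 5) 2, h0 (2 * p - 5) 2 (by omega), had 6, had (2 * p - 1), had (2 * p - 2),
    hda.1 2, hda.1 3, e3, e6] at m
  have m'' : t * (wittCocycle K 2 3 - wittCocycle K 3 (2 * p - 5) - wittCocycle K 2 (2 * p - 5)) *
      d 2 (2 * p - 1) = 0 := by
    linear_combination m - t ^ 2 * m' - t * d 2 (2 * p - 1) *
      (wittCocycle_isAdmissible K).1 2 (2 * p - 5)
  exact (mul_eq_zero.1 m'').resolve_left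
    (mul_ne_zero ht0 (wittCocycle_defect_ne_zero K (by omega)))

end Massey

/-- In weight 1 there are exactly two true deformations of `𝔪₀` up to scalar: an
admissible `a` satisfies the cocycle recurrence and has all weight-1 Massey squares
zero if and only if it is a scalar multiple of the 2-family or of the family
`a(j,k) = (k-j)·(j-1)!·(k-1)!/(j+k)!` arising from the subalgebra `L₁{2}` of the
positive part of the Witt algebra. -/
theorem weight_one_true_deformations (K : Type*) [Field K] [CharZero K]
    (a : ℤ → ℤ → K) (ha : IsAdmissible a) :
    (CocycleRec a ∧ ∀ i j k : ℤ, MasseySq 1 a i j k = 0) ↔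
    ∃ t : K,
      (∀ i j : ℤ, a i j = t * Fam K 2 i j) ∨
      (∀ j k : ℤ, 2 ≤ j → j < k →
        a j k = t * ((k - j : ℤ) : K) * ((j - 1).toNat.factorial : K) *
          ((k - 1).toNat.factorial : K) / ((j + k).toNat.factorial : K)) := by
  constructor
  · rintro ⟨hc, hM⟩
    by_cases h3 : a 3 4 = 0
    · by_cases h2 : a 2 3 = 0
      · exact ⟨0, .inl fun i j => by rw [eq_zero_of_leading_zero hc ha hM h2 h3, zero_mul]⟩
      · exact ⟨a 2 3, .inl (eq_fam_two_of_apply_eq_zero hc ha hM h2 h3)⟩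
    · refine ⟨420 * a 3 4, .inr fun j k hj hjk => ?_⟩
      rw [eq_wittCocycle_of_apply_ne_zero hc ha hM h3, wittCocycle, if_pos ⟨hj, by omega⟩]
      ring
  · have smul : ∀ (t : K) (b : ℤ → ℤ → K), CocycleRec b →
        (∀ i j k : ℤ, MasseySq 1 b i j k = 0) → (∀ i j : ℤ, a i j = t * b i j) →
        CocycleRec a ∧ ∀ i j k : ℤ, MasseySq 1 a i j k = 0 := by
      intro t b hc hM hab
      refine ⟨fun i j hi hj => ?_, fun i j k => ?_⟩
      · rw [hab, hab, hab]
        linear_combination t * hc i j hi hj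
      · have h := hM i j k
        unfold MasseySq at h ⊢
        simp only [hab]
        linear_combination t ^ 2 * h
    rintro ⟨t, h | h⟩
    · exact smul t _ (fam_two_cocycleRec K) (fam_two_masseySq K) h
    · refine smul t _ (wittCocycle_cocycleRec K) (wittCocycle_masseySq K) ?_
      have hlt : ∀ i j : ℤ, i < j → a i j = t * wittCocycle K i j := by
        intro i j hij
        by_cases hi : 2 ≤ i
        · rw [h i j hi hij, wittCocycle, if_pos ⟨hi, by omega⟩]
          ring
        · rw [ha.2 i j (by omega), (wittCocycle_isAdmissible K).2 i j (by omega), mul_zero]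
      intro i j
      rcases lt_trichotomy i j with hij | rfl | hij
      · exact hlt i j hij
      · rw [ha.apply_self, (wittCocycle_isAdmissible K).apply_self, mul_zero]
      · rw [ha.1 j i, (wittCocycle_isAdmissible K).1 j i, hlt j i hij]
        ring
end

section
/- For every t ∈ K, the bilinear skew-symmetric bracket on V determined on basis elements by [f_1,f_j]_t = (j−1)·f_{j+1} for all j ≥ 2 and [f_i,f_j]_t = t·(j−i)·f_{i+j} for all i,j ≥ 2, satisfies the Jacobi identity; this gives a true deformation 𝔪₀²(t) of 𝔪₀ of weight 0 (in a rescaled basis) which for t = 1 is the Lie algebra L₁ with relations [f_i,f_j] = (j−i)f_{i+j}. -/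
variable (K : Type*) [Field K] [CharZero K]

/-- Free `K`-module with basis `f_1, f_2, …`: index `n : ℕ` represents `f_{n+1}`. -/
abbrev V := ℕ →₀ K

/-- Structure constants of the deformed bracket `[·,·]_t`: the value of
`[f_{i+1}, f_{j+1}]_t`, so that `[f_1, f_j]_t = (j-1) • f_{j+1}` for `j ≥ 2` and
`[f_i, f_j]_t = t(j-i) • f_{i+j}` for `i, j ≥ 2`. -/
noncomputable def L1c (t : K) (i j : ℕ) : V K :=
  if i = 0 ∧ 1 ≤ j then (j : K) • Finsupp.single (j + 1) 1
  else if j = 0 ∧ 1 ≤ i then -((i : K) • Finsupp.single (i + 1) 1)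
  else if 1 ≤ i ∧ 1 ≤ j then (t * ((j : K) - (i : K))) • Finsupp.single (i + j + 1) 1
  else 0

/-- The deformed bracket `[·,·]_t`, extended bilinearly from its values on basis
vectors. -/
noncomputable def brkt (t : K) (x y : V K) : V K :=
  x.sum fun i xi => y.sum fun j yj => (xi * yj) • L1c K t i j

section

variable (F : Type*) [Field F]

/-- The scalar in `L1c F t i j = structureCoeff F t i j • f_{i+j+2}`. -/
def structureCoeff (t : F) (i j : ℕ) : F :=
  (if i = 0 ∨ j = 0 then 1 else t) * ((j : F) - (i : F))

theorem L1c_eq (t : F) (i j : ℕ) :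
    L1c F t i j = Finsupp.single (i + j + 1) (structureCoeff F t i j) := by
  rcases i with _ | i <;> rcases j with _ | j <;> simp [L1c, structureCoeff]

theorem brkt_add_left (t : F) (x x' y : V F) :
    brkt F t (x + x') y = brkt F t x y + brkt F t x' y := by
  unfold brkt
  rw [Finsupp.sum_add_index']
  · simp
  · simp [add_mul, add_smul, Finsupp.sum_add]

theorem brkt_add_right (t : F) (x y y' : V F) :
    brkt F t x (y + y') = brkt F t x y + brkt F t x y' := by
  unfold brkt
  rw [← Finsupp.sum_add]
  congr 1
  ext1 i
  ext1 a
  rw [Finsupp.sum_add_index']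
  · simp
  · simp [mul_add, add_smul]

theorem brkt_zero_left (t : F) (y : V F) : brkt F t 0 y = 0 := by
  simp [brkt]

theorem brkt_zero_right (t : F) (x : V F) : brkt F t x 0 = 0 := by
  simp [brkt]

theorem brkt_single_single (t : F) (i j : ℕ) (a b : F) :
    brkt F t (Finsupp.single i a) (Finsupp.single j b) =
      Finsupp.single (i + j + 1) (a * b * structureCoeff F t i j) := by
  simp [brkt, L1c_eq]

theorem structureCoeff_skew (t : F) (i j : ℕ) :
    structureCoeff F t i j = -structureCoeff F t j i := by
  simp only [structureCoeff, or_comm (a := i = 0)]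
  ring

theorem structureCoeff_jacobi (t : F) (i j k : ℕ) :
    structureCoeff F t i j * structureCoeff F t (i + j + 1) k +
      structureCoeff F t j k * structureCoeff F t (j + k + 1) i +
      structureCoeff F t k i * structureCoeff F t (k + i + 1) j = 0 := by
  rcases i with _ | i <;> rcases j with _ | j <;> rcases k with _ | k <;>
    simp [structureCoeff] <;> ring

theorem brkt_skew (t : F) (x y : V F) : brkt F t x y = -brkt F t y x := by
  induction x using Finsupp.induction_linear with
  | zero => simp [brkt_zero_left, brkt_zero_right]
  | add x x' hx hx' => rw [brkt_add_left, brkt_add_right, hx, hx', neg_add]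
  | single i a =>
    induction y using Finsupp.induction_linear with
    | zero => simp [brkt_zero_left, brkt_zero_right]
    | add y y' hy hy' => rw [brkt_add_left, brkt_add_right, hy, hy', neg_add]
    | single j b =>
      rw [brkt_single_single, brkt_single_single, ← Finsupp.single_neg, add_comm j i,
        structureCoeff_skew]
      congr 1
      ring

theorem brkt_jacobi (t : F) (x y z : V F) :
    brkt F t (brkt F t x y) z + brkt F t (brkt F t y z) x +
      brkt F t (brkt F t z x) y = 0 := by
  induction x using Finsupp.induction_linear with
  | zero => simp [brkt_zero_left, brkt_zero_right]
  | add x x' hx hx' =>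
    simp only [brkt_add_left, brkt_add_right]
    linear_combination (norm := module) hx + hx'
  | single i a =>
    induction y using Finsupp.induction_linear with
    | zero => simp [brkt_zero_left, brkt_zero_right]
    | add y y' hy hy' =>
      simp only [brkt_add_left, brkt_add_right]
      linear_combination (norm := module) hy + hy'
    | single j b =>
      induction z using Finsupp.induction_linear with
      | zero => simp [brkt_zero_left, brkt_zero_right]
      | add z z' hz hz' =>
        simp only [brkt_add_left, brkt_add_right]
        linear_combination (norm := module) hz + hz'
      | single k c =>
        simp only [brkt_single_single]
        rw [show j + k + 1 + i + 1 = i + j + 1 + k + 1 by ring,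
          show k + i + 1 + j + 1 = i + j + 1 + k + 1 by ring,
          ← Finsupp.single_add, ← Finsupp.single_add, Finsupp.single_eq_zero]
        linear_combination a * b * c * structureCoeff_jacobi F t i j k

end

/-- For every `t`, the bilinear skew-symmetric bracket `[·,·]_t` satisfies the Jacobi
identity; this is the true deformation `𝔪₀²(t)` of `𝔪₀` of weight 0 (in a rescaled
basis), which for `t = 1` is the Lie algebra `L₁`. -/
theorem m0_deforms_to_L1 (t : K) :
    (∀ x y : V K, brkt K t x y = -brkt K t y x) ∧
    (∀ x y z : V K,
      brkt K t (brkt K t x y) z + brkt K t (brkt K t y z) x +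
        brkt K t (brkt K t z x) y = 0) := by
  exact ⟨brkt_skew K t, brkt_jacobi K t⟩
end
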